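/- For all π̄ ∈ E₁ and p̄ ∈ E₂: ‖π*(π̄) − π(π̄,p̄)‖² ≤ (2D̄r₂/(r₁−ℓ₁))·‖p̄ − p(π̄,p̄)‖. -/

import Mathlib

open scoped RealInnerProductSpace

/-- The regularized function `χ(π,p,π̄,p̄) = f(π,p) + (r₁/2)‖π−π̄‖² − (r₂/2)‖p−p̄‖²`. -/
noncomputable def chi {E₁ E₂ : Type*} [NormedAddCommGroup E₁] [NormedAddCommGroup E₂]
    (f : E₁ → E₂ → ℝ) (r₁ r₂ : ℝ) (π : E₁) (p : E₂) (πb : E₁) (pb : E₂) : ℝ :=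
  f π p + r₁ / 2 * ‖π - πb‖ ^ 2 - r₂ / 2 * ‖p - pb‖ ^ 2

theorem aux_lim (A C : ℝ) (h : ∀ t : ℝ, 0 < t → t ≤ 1 → 0 ≤ t * A + t ^ 2 * C) : 0 ≤ A := by
  by_contra hA
  push Not at hA
  have hC : 0 < |C| + 1 := by positivity
  have hx : 0 < -A / (|C| + 1) := div_pos (by linarith) hC
  set t := min 1 (-A / (|C| + 1) / 2) with ht
  have ht0 : 0 < t := lt_min one_pos (by linarith)
  have h1 := h t ht0 (min_le_left _ _)
  have h2 : t ≤ -A / (|C| + 1) / 2 := min_le_right _ _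
  have h3 : t * (|C| + 1) ≤ -A / 2 := by
    have := mul_le_mul_of_nonneg_right h2 hC.le
    have e : -A / (|C| + 1) / 2 * (|C| + 1) = -A / 2 := by field_simp
    linarith
  have h4 : 0 ≤ A + t * C := by
    by_contra h5
    push Not at h5
    nlinarith
  have h6 : t * C ≤ t * |C| := mul_le_mul_of_nonneg_left (le_abs_self C) ht0.le
  nlinarith

theorem aux_mem {E : Type*} [NormedAddCommGroup E] [InnerProductSpace ℝ E]
    {S : Set E} (hS : Convex ℝ S) {x y : E} (hx : x ∈ S) (hy : y ∈ S) {t : ℝ}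
    (h0 : 0 ≤ t) (h1 : t ≤ 1) : x + t • (y - x) ∈ S :=
  hS.add_smul_sub_mem hx hy ⟨h0, h1⟩

theorem aux_sq {E : Type*} [NormedAddCommGroup E] [InnerProductSpace ℝ E]
    (x d z : E) (t : ℝ) :
    ‖x + t • d - z‖ ^ 2 = ‖x - z‖ ^ 2 + 2 * t * ⟪x - z, d⟫ + t ^ 2 * ‖d‖ ^ 2 := by
  have : x + t • d - z = (x - z) + t • d := by abel
  rw [this, norm_add_sq_real, inner_smul_right, norm_smul, mul_pow, Real.norm_eq_abs, sq_abs]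
  ring

theorem aux_descent {E : Type*} [NormedAddCommGroup E] [InnerProductSpace ℝ E] [CompleteSpace E]
    {S : Set E} (hS : Convex ℝ S) (f : E → ℝ) (g : E → E) (hg : ∀ x, HasGradientAt f (g x) x)
    (L : ℝ) (hL : ∀ x ∈ S, ∀ y ∈ S, ‖g x - g y‖ ≤ L * ‖x - y‖)
    (x y : E) (hx : x ∈ S) (hy : y ∈ S) :
    f x + ⟪g x, y - x⟫ - L / 2 * ‖y - x‖ ^ 2 ≤ f y := by
  set d := y - x with hd
  have hder : ∀ t : ℝ, HasDerivAt
      (fun t : ℝ => f (x + t • d) - t * ⟪g x, d⟫ + L / 2 * t ^ 2 * ‖d‖ ^ 2)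
      (⟪g (x + t • d), d⟫ - ⟪g x, d⟫ + L * t * ‖d‖ ^ 2) t := by
    intro t
    have h1 : HasDerivAt (fun t : ℝ => x + t • d) d t := by
      simpa using ((hasDerivAt_id t).smul_const d).const_add x
    have h2 := (hg (x + t • d)).hasFDerivAt.comp_hasDerivAt t h1
    have h3 := (hasDerivAt_id t).mul_const ⟪g x, d⟫
    have h4 := (((hasDerivAt_id t).pow 2).const_mul (L / 2)).mul_const (‖d‖ ^ 2)
    have h5 := (h2.sub h3).add h4
    refine HasDerivAt.congr_deriv (h5.congr_of_eventuallyEq ?_) ?_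
    · refine Filter.Eventually.of_forall fun s => ?_
      simp
    · simp
      left
      ring
  have hm : MonotoneOn (fun t : ℝ => f (x + t • d) - t * ⟪g x, d⟫ + L / 2 * t ^ 2 * ‖d‖ ^ 2)
      (Set.Icc 0 1) := by
    apply monotoneOn_of_deriv_nonneg (convex_Icc 0 1)
    · exact fun t _ => (hder t).continuousAt.continuousWithinAt
    · exact fun t _ => (hder t).differentiableAt.differentiableWithinAt
    · intro t ht
      rw [interior_Icc] at ht
      rw [(hder t).deriv, ← inner_sub_left]
      have h1 := hL _ (aux_mem hS hx hy ht.1.le ht.2.le) x hx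
      have h2 := abs_real_inner_le_norm (g (x + t • d) - g x) d
      have h3 := neg_abs_le ⟪g (x + t • d) - g x, d⟫
      rw [add_sub_cancel_left, norm_smul, Real.norm_eq_abs, abs_of_pos ht.1] at h1
      have h4 := mul_le_mul_of_nonneg_right h1 (norm_nonneg d)
      nlinarith
  have := hm (Set.left_mem_Icc.2 zero_le_one) (Set.right_mem_Icc.2 zero_le_one) zero_le_one
  simp [hd] at this
  simp only [hd]
  linarith

/-- `‖π*(π̄) − π(π̄,p̄)‖² ≤ (2D̄r₂/(r₁−ℓ₁))‖p̄ − p(π̄,p̄)‖`. -/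
theorem proximal_point_gap_bound
    {E₁ : Type*} [NormedAddCommGroup E₁] [InnerProductSpace ℝ E₁] [FiniteDimensional ℝ E₁]
    {E₂ : Type*} [NormedAddCommGroup E₂] [InnerProductSpace ℝ E₂] [FiniteDimensional ℝ E₂]
    (P : Set E₁) (Q : Set E₂)
    (hPne : P.Nonempty) (hPcpt : IsCompact P) (hPconv : Convex ℝ P)
    (hQne : Q.Nonempty) (hQcpt : IsCompact Q) (hQconv : Convex ℝ Q)
    (f : E₁ → E₂ → ℝ) (hf : ContDiff ℝ 1 (fun q : E₁ × E₂ => f q.1 q.2))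
    (gπ : E₁ → E₂ → E₁) (gp : E₁ → E₂ → E₂)
    (hgπ : ∀ π p, HasGradientAt (fun π' => f π' p) (gπ π p) π)
    (hgp : ∀ π p, HasGradientAt (fun p' => f π p') (gp π p) p)
    (ℓ₁ ℓ₂ : ℝ) (hℓ₁ : 0 < ℓ₁) (hℓ₂ : 0 < ℓ₂)
    (hlipπ : ∀ π ∈ P, ∀ π' ∈ P, ∀ p ∈ Q, ∀ p' ∈ Q,
      ‖gπ π p - gπ π' p'‖ ≤ ℓ₁ * (‖π - π'‖ + ‖p - p'‖))
    (hlipp : ∀ π ∈ P, ∀ π' ∈ P, ∀ p ∈ Q, ∀ p' ∈ Q,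
      ‖gp π p - gp π' p'‖ ≤ ℓ₂ * (‖π - π'‖ + ‖p - p'‖))
    (r₁ r₂ : ℝ) (hr₁ : ℓ₁ < r₁) (hr₂ : ℓ₂ < r₂)
    -- `psel π π̄ p̄` is the unique maximizer of `p ↦ χ(π,p,π̄,p̄)` over `𝒫`
    (psel : E₁ → E₁ → E₂ → E₂)
    (hpsel : ∀ π ∈ P, ∀ (πb : E₁) (pb : E₂), psel π πb pb ∈ Q ∧
      ∀ p' ∈ Q, chi f r₁ r₂ π p' πb pb ≤ chi f r₁ r₂ π (psel π πb pb) πb pb)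
    -- `πsel2 π̄ p̄` is the unique minimizer over `Π` of `π ↦ max_{p∈𝒫} χ(π,p,π̄,p̄)`
    (πsel2 : E₁ → E₂ → E₁)
    (hπsel2 : ∀ (πb : E₁) (pb : E₂), πsel2 πb pb ∈ P ∧
      ∀ π' ∈ P, sSup ((fun p => chi f r₁ r₂ (πsel2 πb pb) p πb pb) '' Q) ≤
        sSup ((fun p => chi f r₁ r₂ π' p πb pb) '' Q))
    -- `πstar π̄` is the unique minimizer over `Π` of `ψ(π;π̄) = max_{p∈𝒫}f(π,p) + (r₁/2)‖π−π̄‖²`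
    (πstar : E₁ → E₁)
    (hπstar : ∀ πb : E₁, πstar πb ∈ P ∧
      ∀ π' ∈ P, sSup ((fun p => f (πstar πb) p) '' Q) + r₁ / 2 * ‖πstar πb - πb‖ ^ 2 ≤
        sSup ((fun p => f π' p) '' Q) + r₁ / 2 * ‖π' - πb‖ ^ 2)
    -- gradient dominance of `f` in `p`
    (Dbar : ℝ) (hDbar : 0 < Dbar)
    (hgd : ∀ π ∈ P, ∀ p ∈ Q, ∀ w : E₂, (∀ p' ∈ Q, ⟪w, p' - p⟫ ≤ 0) →
      sSup ((fun p' => f π p') '' Q) - f π p ≤ Dbar * ‖gp π p - w‖) :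
    ∀ (πb : E₁) (pb : E₂),
      ‖πstar πb - πsel2 πb pb‖ ^ 2 ≤
        2 * Dbar * r₂ / (r₁ - ℓ₁) * ‖pb - psel (πsel2 πb pb) πb pb‖ := by
  intro πb pb
  obtain ⟨ha, hamin⟩ := hπstar πb
  obtain ⟨hb, hbmin⟩ := hπsel2 πb pb
  set a := πstar πb with ha_def
  set b := πsel2 πb pb with hb_def
  -- first order condition for the inner maximizer
  have hfoc : ∀ π ∈ P, ∀ p' ∈ Q,
      ⟪gp π (psel π πb pb) - r₂ • (psel π πb pb - pb), p' - psel π πb pb⟫ ≤ 0 := by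
    intro π hπ p' hp'
    obtain ⟨hq, hqmax⟩ := hpsel π hπ πb pb
    set q := psel π πb pb
    rw [← neg_nonneg]
    apply aux_lim _ ((ℓ₂ + r₂) / 2 * ‖p' - q‖ ^ 2)
    intro t ht0 ht1
    have hm := aux_mem hQconv hq hp' ht0.le ht1
    have h1 := aux_descent hQconv (f π) (gp π) (hgp π) ℓ₂
      (fun x hx y hy => by simpa using hlipp π hπ π hπ x hx y hy) q _ hq hm
    have h2 := hqmax _ hm
    simp only [chi] at h2
    rw [aux_sq] at h2
    rw [add_sub_cancel_left, inner_smul_right, norm_smul, Real.norm_eq_abs, mul_pow, sq_abs] at h1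
    rw [inner_sub_left, real_inner_smul_left]
    linarith
  obtain ⟨hq, hqmax⟩ := hpsel b hb πb pb
  set q := psel b πb pb with hq_def
  have hsup : ∀ π ∈ P, sSup ((fun p => chi f r₁ r₂ π p πb pb) '' Q)
      = chi f r₁ r₂ π (psel π πb pb) πb pb := by
    intro π hπ
    obtain ⟨h1, h2⟩ := hpsel π hπ πb pb
    exact IsGreatest.csSup_eq ⟨⟨_, h1, rfl⟩, by rintro _ ⟨p, hp, rfl⟩; exact h2 p hp⟩
  set d := a - b with hd
  have hr2 : 0 < r₂ - ℓ₂ := by linarith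
  -- first order condition for b
  have hopt : 0 ≤ ⟪gπ b q + r₁ • (b - πb), d⟫ := by
    apply aux_lim _ (ℓ₁ * (‖d‖ + ℓ₂ * ‖d‖ / (r₂ - ℓ₂)) * ‖d‖ + (ℓ₁ + r₁) / 2 * ‖d‖ ^ 2)
    intro t ht0 ht1
    have hc : b + t • d ∈ P := aux_mem hPconv hb ha ht0.le ht1
    set c := b + t • d with hc_def
    obtain ⟨hqc, hqcmax⟩ := hpsel c hc πb pb
    have f1 := hfoc b hb _ hqc
    have f2 := hfoc c hc _ hq
    rw [← hq_def] at f1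
    have hmin := hbmin c hc
    rw [hsup b hb, hsup c hc, ← hq_def] at hmin
    set u := psel c πb pb
    have hmax := hqmax u hqc
    have hcb : c - b = t • d := by rw [hc_def]; abel
    have hncb : ‖c - b‖ = t * ‖d‖ := by
      rw [hcb, norm_smul, Real.norm_eq_abs, abs_of_pos ht0]
    have hs : ‖u - q‖ ≤ t * (ℓ₂ * ‖d‖ / (r₂ - ℓ₂)) := by
      have e1 : ⟪gp c u - gp b q, u - q⟫ ≥ r₂ * ‖u - q‖ ^ 2 := by
        have e : ⟪gp b q - r₂ • (q - pb), u - q⟫ + ⟪gp c u - r₂ • (u - pb), q - u⟫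
            = r₂ * ‖u - q‖ ^ 2 - ⟪gp c u - gp b q, u - q⟫ := by
          rw [← neg_sub u q, inner_neg_right, ← sub_eq_add_neg, ← inner_sub_left,
            ← real_inner_self_eq_norm_sq, ← real_inner_smul_left, ← inner_sub_left]
          congr 1
          module
        linarith
      have e2 := real_inner_le_norm (gp c u - gp b q) (u - q)
      have e3 := hlipp c hc b hb u hqc q hq
      rw [hncb] at e3
      rw [← mul_div_assoc, le_div_iff₀ hr2]
      by_cases hz : ‖u - q‖ = 0
      · rw [hz, zero_mul]; positivity
      · have hz' : 0 < ‖u - q‖ := lt_of_le_of_ne (norm_nonneg _) (Ne.symm hz)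
        have e4 := mul_le_mul_of_nonneg_right e3 hz'.le
        have e5 : (r₂ * ‖u - q‖) * ‖u - q‖ ≤ ℓ₂ * (t * ‖d‖ + ‖u - q‖) * ‖u - q‖ := by nlinarith
        have e6 := le_of_mul_le_mul_right e5 hz'
        linarith
    have h1 := aux_descent hPconv (fun x => f x u) (fun x => gπ x u) (fun x => hgπ x u) ℓ₁
      (fun x hx y hy => by simpa using hlipπ x hx y hy u hqc u hqc) c b hc hb
    have hl := hlipπ c hc b hb u hqc q hq
    have h3 : ⟪gπ c u - gπ b q, d⟫ ≤ ℓ₁ * (t * ‖d‖ + t * (ℓ₂ * ‖d‖ / (r₂ - ℓ₂))) * ‖d‖ := by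
      refine (real_inner_le_norm _ _).trans (mul_le_mul_of_nonneg_right (hl.trans ?_)
        (norm_nonneg _))
      rw [hncb]
      gcongr
    simp only [chi] at hmin hmax
    rw [hc_def, aux_sq, ← hc_def] at hmin
    rw [norm_sub_rev b c, hncb, ← neg_sub c b, hcb, inner_neg_right, inner_smul_right] at h1
    rw [inner_sub_left] at h3
    rw [inner_add_left, real_inner_smul_left]
    have h4 := mul_le_mul_of_nonneg_left h3 ht0.le
    linarith
  -- descent at b
  have h1 := aux_descent hPconv (fun x => f x q) (fun x => gπ x q) (fun x => hgπ x q) ℓ₁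
      (fun x hx y hy => by simpa using hlipπ x hx y hy q hq q hq) b a hb ha
  have h2 := hgd b hb q hq _ (hfoc b hb)
  rw [← hq_def, sub_sub_cancel, norm_smul, Real.norm_eq_abs, abs_of_pos (by linarith),
    norm_sub_rev] at h2
  have h3 := hamin b hb
  have h4 : f a q ≤ sSup ((fun p => f a p) '' Q) := by
    apply le_csSup
    · apply (hQcpt.image _).bddAbove
      exact hf.continuous.comp (Continuous.prodMk_right a)
    · exact ⟨q, hq, rfl⟩
  have h5 := aux_sq b d πb 1
  rw [one_smul, hd, add_sub_cancel] at h5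
  rw [inner_add_left, real_inner_smul_left, hd] at hopt
  have hr : 0 < r₁ - ℓ₁ := by linarith
  rw [div_mul_eq_mul_div, le_div_iff₀ hr]
  rw [h5] at h3
  linarith
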